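/- Fix p > 1, α ∈ (1/2,1), β as in (2.8), g positive and differentiable with g' ≠ 0, and F(x,y,z) = α(g(x)+g'(x)y)^p(z+1) + (1-α)(g(x)−g'(x)y)^p(z−1). Let s₀(x) = −β g(x)/g'(x), and let s, s' be real numbers with |s| < g(x)/|g'(x)| and s' ≥ 1 (assume also s₀ differentiable at x). Then F(x, s, s') − F(x, s₀(x), s₀'(x)) ≥ ∂_y F(x, s₀(x), s₀'(x))(s − s₀(x)) + ∂_z F(x, s₀(x), s₀'(x))(s' − s₀'(x)). -/

import Mathlib

lemma rpow_tangent_aux (p A B : ℝ) (hp : 1 < p) (hA : 0 < A) (hB : 0 < B) :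
    B ^ p + p * B ^ (p - 1) * (A - B) ≤ A ^ p := by
  have h := one_add_mul_self_le_rpow_one_add (s := A / B - 1)
    (by have := div_pos hA hB; linarith) hp.le
  have e : 1 + (A / B - 1) = A / B := by ring
  rw [e, Real.div_rpow hA.le hB.le, le_div_iff₀ (Real.rpow_pos_of_pos hB p)] at h
  have e2 : B ^ p = B ^ (p - 1) * B := by
    rw [← Real.rpow_add_one hB.ne']; congr 1; ring
  have e3 : (1 + p * (A / B - 1)) * B ^ p = B ^ p + p * B ^ (p - 1) * (A - B) := by
    rw [e2]; field_simp
  linarith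

/-- Lemma 4 (inequality (2.9)): a pointwise subgradient-type inequality for
`F(x,y,z) = α(g+g'y)^p(z+1) + (1-α)(g−g'y)^p(z−1)`, where
`∂_y F(x,y,z) = p g'(x)[α(g+g'y)^{p-1}(z+1) − (1-α)(g−g'y)^{p-1}(z−1)]` and
`∂_z F(x,y,z) = α(g+g'y)^p + (1-α)(g−g'y)^p`. -/
theorem key_subgradient_inequality (p α : ℝ) (hp : 1 < p) (hα : 1 / 2 < α) (hα' : α < 1)
    (g : ℝ → ℝ) (hg_diff : DifferentiableOn ℝ g {0}ᶜ)
    (hg_pos : ∀ x ≠ 0, 0 < g x) (hg' : ∀ x ≠ 0, deriv g x ≠ 0)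
    (x : ℝ) (hx : x ≠ 0) (s s' s₀' : ℝ)
    (hs : |s| < g x / |deriv g x|) (hs' : 1 ≤ s')
    (hs₀ : HasDerivAt (fun u => -((α ^ (1 / (p - 1)) - (1 - α) ^ (1 / (p - 1))) /
        (α ^ (1 / (p - 1)) + (1 - α) ^ (1 / (p - 1)))) * g u / deriv g u) s₀' x) :
    let β := (α ^ (1 / (p - 1)) - (1 - α) ^ (1 / (p - 1))) /
             (α ^ (1 / (p - 1)) + (1 - α) ^ (1 / (p - 1)))
    let s₀ : ℝ := -β * g x / deriv g x
    let F : ℝ → ℝ → ℝ := fun y z =>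
      α * (g x + deriv g x * y) ^ p * (z + 1) +
        (1 - α) * (g x - deriv g x * y) ^ p * (z - 1)
    F s s' - F s₀ s₀' ≥
      (p * deriv g x * (α * (g x + deriv g x * s₀) ^ (p - 1) * (s₀' + 1) -
          (1 - α) * (g x - deriv g x * s₀) ^ (p - 1) * (s₀' - 1))) * (s - s₀) +
        (α * (g x + deriv g x * s₀) ^ p + (1 - α) * (g x - deriv g x * s₀) ^ p) *
          (s' - s₀') := by
  intro β s₀ F
  have hG := hg_pos x hx
  have hd := hg' x hx
  have hq : p - 1 ≠ 0 := by linarith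
  set G := g x with hGdef
  set d := deriv g x with hddef
  have ha : 0 < α ^ (1 / (p - 1)) := Real.rpow_pos_of_pos (by linarith) _
  have hb : 0 < (1 - α) ^ (1 / (p - 1)) := Real.rpow_pos_of_pos (by linarith) _
  have ha1 : (α ^ (1 / (p - 1))) ^ (p - 1) = α := by
    rw [← Real.rpow_mul (by linarith), one_div_mul_cancel hq, Real.rpow_one]
  have hb1 : ((1 - α) ^ (1 / (p - 1))) ^ (p - 1) = 1 - α := by
    rw [← Real.rpow_mul (by linarith), one_div_mul_cancel hq, Real.rpow_one]
  have hA0 : G + d * s₀ = (1 - α) ^ (1 / (p - 1)) *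
      (2 * G / (α ^ (1 / (p - 1)) + (1 - α) ^ (1 / (p - 1)))) := by
    simp only [s₀, β, ← hGdef, ← hddef]
    generalize α ^ (1 / (p - 1)) = a at *
    generalize (1 - α) ^ (1 / (p - 1)) = b at *
    have : a + b ≠ 0 := by linarith
    field_simp
    ring
  have hB0 : G - d * s₀ = α ^ (1 / (p - 1)) *
      (2 * G / (α ^ (1 / (p - 1)) + (1 - α) ^ (1 / (p - 1)))) := by
    simp only [s₀, β, ← hGdef, ← hddef]
    generalize α ^ (1 / (p - 1)) = a at *
    generalize (1 - α) ^ (1 / (p - 1)) = b at *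
    have : a + b ≠ 0 := by linarith
    field_simp
    ring
  have hc : 0 < 2 * G / (α ^ (1 / (p - 1)) + (1 - α) ^ (1 / (p - 1))) := by positivity
  have hA0p : 0 < G + d * s₀ := by rw [hA0]; positivity
  have hB0p : 0 < G - d * s₀ := by rw [hB0]; positivity
  have hK : α * (G + d * s₀) ^ (p - 1) = (1 - α) * (G - d * s₀) ^ (p - 1) := by
    rw [hA0, hB0, Real.mul_rpow hb.le hc.le, Real.mul_rpow ha.le hc.le, ha1, hb1]
    ring
  have hds : |d * s| < G := by
    rw [abs_mul, mul_comm]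
    exact (lt_div_iff₀ (abs_pos.mpr hd)).mp hs
  obtain ⟨h1, h2⟩ := abs_lt.mp hds
  have tA := rpow_tangent_aux p (G + d * s) (G + d * s₀) hp (by linarith) hA0p
  have tB := rpow_tangent_aux p (G - d * s) (G - d * s₀) hp (by linarith) hB0p
  have uA := mul_le_mul_of_nonneg_left tA
    (mul_nonneg (by linarith : 0 ≤ α) (by linarith : 0 ≤ s' + 1))
  have uB := mul_le_mul_of_nonneg_left tB
    (mul_nonneg (by linarith : 0 ≤ 1 - α) (by linarith : 0 ≤ s' - 1))
  simp only [F, ← hGdef, ← hddef]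
  clear_value s₀
  generalize (G + d * s₀) ^ (p - 1) = X at *
  generalize (G - d * s₀) ^ (p - 1) = Y at *
  have k : (p * d * (α * X * (s₀' + 1) - (1 - α) * Y * (s₀' - 1))) * (s - s₀)
      = α * (s' + 1) * (p * X * (d * (s - s₀))) - (1 - α) * (s' - 1) * (p * Y * (d * (s - s₀))) := by
    linear_combination (p * d * (s - s₀) * (s₀' - s')) * hK
  rw [k]
  linarith
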